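/- Let G be a discrete group and L a length function on G with bounded doubling, say |B(2r)| ≤ C_L·|B(r)| for all r ≥ 1, and fix R = 2^K for an integer K ≥ 2. Then there is a constant C₁ < ∞, depending only on C_L and R, such that for every finitely supported f : G → ℂ and every integer n ≥ 1, ‖λ_{g_n·f}‖ ≤ C₁ · R^{−n} · J_D(f), where g_n·f denotes the pointwise product. -/

import Mathlib

open scoped ENNReal ComplexConjugate

noncomputable section

variable {G : Type*}

/-- The Hilbert space `ℓ²(G)` of square-summable complex-valued functions on `G`. -/
abbrev l2 (G : Type*) : Type _ := lp (fun _ : G => ℂ) 2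

variable [Group G]

/-- A length function on a group `G`: subadditive, symmetric under inverses,
and vanishing exactly at the identity. -/
structure IsLengthFunction (L : G → ℝ) : Prop where
  nonneg : ∀ x, 0 ≤ L x
  subadd : ∀ x y, L (x * y) ≤ L x + L y
  inv_eq : ∀ x, L x⁻¹ = L x
  eq_zero_iff : ∀ x, L x = 0 ↔ x = 1

/-- The ball `B(r) = {x ∈ G : L x ≤ r}`. -/
def lball (L : G → ℝ) (r : ℝ) : Set G := {x : G | L x ≤ r}

/-- A length function is proper if all balls are finite. -/
def IsProperLF (L : G → ℝ) : Prop := ∀ r : ℝ, (lball L r).Finite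

/-- Bounded doubling: `L` is proper and there is `C < ∞` with
`|B(2r)| ≤ C |B(r)|` for all `r ≥ 1`. -/
def HasBoundedDoubling (L : G → ℝ) : Prop :=
  IsProperLF L ∧ ∃ C : ℝ, ∀ r : ℝ, 1 ≤ r →
    ((lball L (2 * r)).ncard : ℝ) ≤ C * ((lball L r).ncard : ℝ)

/-- `T` is the convolution operator `λ_f`, `(λ_f ξ)(x) = Σ_y f(xy⁻¹) ξ(y)`. -/
def IsConvOp (f : G → ℂ) (T : l2 G →L[ℂ] l2 G) : Prop :=
  ∀ (ξ : l2 G) (x : G), T ξ x = ∑' y : G, f (x * y⁻¹) * ξ y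

/-- `T` is the commutator `[D, λ_f]` for `D = M_L`, i.e.
`([D,λ_f] ξ)(x) = Σ_y (L x − L y) f(xy⁻¹) ξ(y)`. -/
def IsCommOp (L : G → ℝ) (f : G → ℂ) (T : l2 G →L[ℂ] l2 G) : Prop :=
  ∀ (ξ : l2 G) (x : G), T ξ x = ∑' y : G, ((L x : ℂ) - (L y : ℂ)) * f (x * y⁻¹) * ξ y

/-- `T` is the truncated operator `(I − M_{2r}) λ_f M_r`. -/
def IsTruncOp (L : G → ℝ) (f : G → ℂ) (r : ℝ) (T : l2 G →L[ℂ] l2 G) : Prop :=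
  ∀ (ξ : l2 G) (x : G),
    T ξ x = if L x ≤ 2 * r then 0
      else ∑' y : G, (if L y ≤ r then f (x * y⁻¹) * ξ y else 0)

/-- The seminorm `J_D(f) = sup_{r>0} r ‖(I − M_{2r}) λ_f M_r‖`. -/
def JD (L : G → ℝ) (f : G → ℂ) : ℝ :=
  sSup {a : ℝ | ∃ r : ℝ, 0 < r ∧ ∃ T : l2 G →L[ℂ] l2 G, IsTruncOp L f r T ∧ a = r * ‖T‖}

/-- The convolution `h* ∗ k`, where `h*(z) = conj (h z⁻¹)`. -/
def starConv (h k : G → ℂ) : G → ℂ :=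
  fun x => ∑' z : G, conj (h z⁻¹) * k (z⁻¹ * x)

/-- The `ℓ²` norm `‖h‖₂ = (Σ_x |h x|²)^{1/2}` of a function `h : G → ℂ`. -/
def l2norm (h : G → ℂ) : ℝ := Real.sqrt (∑' x : G, ‖h x‖ ^ 2)

/-- The complex-valued cutoff function `g_n = h_n* ∗ k_n`, where
`k_n = |B(R^{n-1})|⁻¹ χ_{B(R^{n-1})}` and `h_n = χ_{A(R^n, R^{n+1})}`. -/
def gCut (L : G → ℝ) (R : ℝ) (n : ℕ) : G → ℂ :=
  fun x => ∑' z : G,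
    (if R ^ n < L z⁻¹ ∧ L z⁻¹ ≤ R ^ (n + 1) then (1 : ℂ) else 0) *
      (((lball L (R ^ (n - 1))).ncard : ℂ)⁻¹ *
        if L (z⁻¹ * x) ≤ R ^ (n - 1) then 1 else 0)

lemma l2_sum_sq_le {α : Type*} (ξ : l2 α) (s : Finset α) : ∑ x ∈ s, ‖ξ x‖ ^ 2 ≤ ‖ξ‖ ^ 2 := by
  simpa using lp.sum_rpow_le_norm_rpow (p := 2) (by norm_num) ξ s

lemma l2_norm_le_of_forall_sum_sq_le {α : Type*} {C : ℝ} (hC : 0 ≤ C) {ξ : l2 α}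
    (h : ∀ s : Finset α, ∑ x ∈ s, ‖ξ x‖ ^ 2 ≤ C ^ 2) : ‖ξ‖ ≤ C :=
  lp.norm_le_of_forall_sum_le (p := 2) (by norm_num) hC fun s => by simpa using h s

open Classical in
/-- A function on `α` cut off to a finite set, as an element of `ℓ²(α)`. -/
def l2Restrict {α : Type*} (s : Finset α) (v : α → ℂ) : l2 α := ∑ y ∈ s, lp.single 2 y (v y)

open Classical in
lemma l2Restrict_apply {α : Type*} (s : Finset α) (v : α → ℂ) (x : α) :
    l2Restrict s v x = if x ∈ s then v x else 0 := by
  rw [l2Restrict, lp.coeFn_sum, Finset.sum_apply]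
  simp [Pi.single_apply]

lemma norm_l2Restrict_sq {α : Type*} (s : Finset α) (v : α → ℂ) :
    ‖l2Restrict s v‖ ^ 2 = ∑ y ∈ s, ‖v y‖ ^ 2 := by
  classical
  simpa [l2Restrict] using lp.norm_sum_single (p := 2) (by norm_num) v s

lemma IsTruncOp.unique {L : G → ℝ} {f : G → ℂ} {r : ℝ} {S T : l2 G →L[ℂ] l2 G}
    (hS : IsTruncOp L f r S) (hT : IsTruncOp L f r T) : S = T := by
  ext ξ x
  rw [hS, hT]

lemma exists_isTruncOp {L : G → ℝ} (hL : IsProperLF L) (f : G →₀ ℂ) (r : ℝ) :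
    ∃ T : l2 G →L[ℂ] l2 G, IsTruncOp L f r T ∧
      ‖T‖ ≤ (lball L r).ncard * ∑ z ∈ f.support, ‖f z‖ := by
  classical
  let c : G → G → ℂ := fun y z => if L (z * y) ≤ 2 * r then 0 else f z
  let E : G → G → (l2 G →L[ℂ] l2 G) := fun y z =>
    (innerSL ℂ (lp.single 2 y (1 : ℂ) : l2 G)).smulRight (lp.single 2 (z * y) (1 : ℂ))
  have hE : ∀ y z, ‖E y z‖ ≤ 1 := fun y z => by
    simp [E, ContinuousLinearMap.norm_smulRight_apply, lp.norm_single]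
  have hc : ∀ y z, ‖c y z‖ ≤ ‖f z‖ := fun y z => by
    simp only [c]; split_ifs <;> simp
  refine ⟨∑ y ∈ (hL r).toFinset, ∑ z ∈ f.support, c y z • E y z, fun ξ x => ?_, ?_⟩
  · have hsum : (∑' y : G, (if L y ≤ r then f (x * y⁻¹) * ξ y else 0)) =
        ∑ y ∈ (hL r).toFinset, f (x * y⁻¹) * ξ y := by
      rw [tsum_eq_sum (s := (hL r).toFinset)]
      · exact Finset.sum_congr rfl fun y hy => if_pos (by simpa [lball] using hy)
      · exact fun y hy => if_neg (by simpa [lball] using hy)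
    have hterm : ∀ y z, (c y z • E y z) ξ x = if z = x * y⁻¹ then c y z * ξ y else 0 := by
      intro y z
      have : x = z * y ↔ z = x * y⁻¹ := by
        rw [eq_mul_inv_iff_mul_eq, eq_comm]
      simp [E, lp.inner_single_left, Pi.single_apply, this]
    have hz : ∀ y, ∑ z ∈ f.support, (c y z • E y z) ξ x = c y (x * y⁻¹) * ξ y := by
      intro y
      simp only [hterm, Finset.sum_ite_eq']
      split_ifs with h
      · rfl
      · simp [c, Finsupp.notMem_support_iff.mp h]
    rw [hsum]
    simp only [sum_apply, lp.coeFn_sum, Finset.sum_apply, hz]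
    simp only [c, inv_mul_cancel_right]
    split_ifs <;> simp
  · calc _ ≤ ∑ y ∈ (hL r).toFinset, ∑ z ∈ f.support, ‖f z‖ := by
          refine (norm_sum_le _ _).trans (Finset.sum_le_sum fun y _ =>
            (norm_sum_le _ _).trans (Finset.sum_le_sum fun z _ => ?_))
          rw [norm_smul]
          exact (mul_le_of_le_one_right (norm_nonneg _) (hE y z)).trans (hc y z)
      _ = _ := by rw [Finset.sum_const, nsmul_eq_mul, Set.ncard_eq_toFinset_card _ (hL r)]

/-- Past the radius of the support of `f`, the truncated operators vanish. -/
lemma IsTruncOp.eq_zero {L : G → ℝ} (hL : IsLengthFunction L) {f : G → ℂ} {r : ℝ}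
    (hf : ∀ z, f z ≠ 0 → L z ≤ r) {T : l2 G →L[ℂ] l2 G} (hT : IsTruncOp L f r T) : T = 0 := by
  ext ξ x
  rw [hT]
  split_ifs with hx
  · rfl
  · have : ∀ y, (if L y ≤ r then f (x * y⁻¹) * ξ y else 0) = 0 := fun y => by
      split_ifs with hy
      · by_contra h
        have h₁ := hf _ (left_ne_zero_of_mul h)
        have h₂ := hL.subadd (x * y⁻¹) y
        rw [inv_mul_cancel_right] at h₂
        linarith
      · rfl
    simp [this]

lemma mul_norm_le_JD {L : G → ℝ} (hL : IsLengthFunction L) (hP : IsProperLF L) (f : G →₀ ℂ)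
    {r : ℝ} (hr : 0 < r) {T : l2 G →L[ℂ] l2 G} (hT : IsTruncOp L f r T) :
    r * ‖T‖ ≤ JD L f := by
  refine le_csSup ?_ ⟨r, hr, T, hT, rfl⟩
  set M := ∑ z ∈ f.support, L z
  have hM : 0 ≤ M := Finset.sum_nonneg fun z _ => hL.nonneg z
  have hS : 0 ≤ ∑ z ∈ f.support, ‖f z‖ := Finset.sum_nonneg fun z _ => norm_nonneg _
  refine ⟨M * ((lball L M).ncard * ∑ z ∈ f.support, ‖f z‖), ?_⟩
  rintro _ ⟨ρ, hρ, S, hS', rfl⟩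
  rcases le_or_gt M ρ with h | h
  · have : S = 0 := hS'.eq_zero hL fun z hz =>
      (Finset.single_le_sum (fun z _ => hL.nonneg z) (Finsupp.mem_support_iff.mpr hz)).trans h
    rw [this, norm_zero, mul_zero]
    positivity
  · obtain ⟨S', h₁, h₂⟩ := exists_isTruncOp hP f ρ
    rw [hS'.unique h₁]
    have : ((lball L ρ).ncard : ℝ) ≤ (lball L M).ncard := by
      exact_mod_cast Set.ncard_le_ncard (fun x (hx : L x ≤ ρ) => hx.trans h.le) (hP M)
    have := h₂.trans (mul_le_mul_of_nonneg_right this hS)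
    gcongr

lemma ncard_lball_pos {L : G → ℝ} (hL : IsLengthFunction L) (hP : IsProperLF L) {r : ℝ}
    (hr : 0 ≤ r) : 0 < (lball L r).ncard :=
  (Set.ncard_pos (hP r)).mpr ⟨1, by simpa [lball, (hL.eq_zero_iff 1).mpr rfl] using hr⟩

/-- The annulus `A(s,t)` as a finite set. -/
def annulusFinset {α : Type*} {L : α → ℝ} (hP : IsProperLF L) (s t : ℝ) : Finset α := by
  classical exact (hP t).toFinset.filter fun x => s < L x

lemma mem_annulusFinset {α : Type*} {L : α → ℝ} (hP : IsProperLF L) {s t : ℝ} {x : α} :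
    x ∈ annulusFinset hP s t ↔ s < L x ∧ L x ≤ t := by
  simp [annulusFinset, lball, and_comm]

lemma gCut_eq_sum {L : G → ℝ} (hL : IsLengthFunction L) (hP : IsProperLF L) (R : ℝ) (n : ℕ)
    (x : G) : gCut L R n x = ∑ w ∈ annulusFinset hP (R ^ n) (R ^ (n + 1)),
      ((lball L (R ^ (n - 1))).ncard : ℂ)⁻¹ * if L (w⁻¹ * x) ≤ R ^ (n - 1) then 1 else 0 := by
  rw [gCut, tsum_eq_sum (s := annulusFinset hP (R ^ n) (R ^ (n + 1)))]
  · refine Finset.sum_congr rfl fun w hw => ?_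
    rw [hL.inv_eq, if_pos ((mem_annulusFinset hP).mp hw), one_mul]
  · intro w hw
    rw [hL.inv_eq, if_neg (fun h => hw ((mem_annulusFinset hP).mpr h)), zero_mul]

lemma IsConvOp.apply_eq_sum {L : G → ℝ} (hL : IsLengthFunction L) (hP : IsProperLF L) {R : ℝ}
    {n : ℕ} {f : G →₀ ℂ} {T : l2 G →L[ℂ] l2 G}
    (hT : IsConvOp (fun x => gCut L R n x * f x) T) (ξ : l2 G) (x : G) :
    T ξ x = ((lball L (R ^ (n - 1))).ncard : ℂ)⁻¹ *
      ∑ w ∈ annulusFinset hP (R ^ n) (R ^ (n + 1)),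
        ∑' y : G, if L y ≤ R ^ (n - 1) then f (w * y⁻¹) * ξ (y * (w⁻¹ * x)) else 0 := by
  set b := ((lball L (R ^ (n - 1))).ncard : ℂ)⁻¹
  have hfin : (Function.support fun y => f (x * y⁻¹)).Finite := by
    refine (f.hasFiniteSupport.image fun z => z⁻¹ * x).subset fun y hy => ⟨x * y⁻¹, hy, ?_⟩
    simp
  rw [hT]
  simp only [gCut_eq_sum hL hP, Finset.sum_mul]
  rw [Summable.tsum_finsetSum, Finset.mul_sum]
  · refine Finset.sum_congr rfl fun w _ => ?_
    rw [← tsum_mul_left, ← (Equiv.mulRight (w⁻¹ * x)).tsum_eq]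
    refine tsum_congr fun y => ?_
    have h₁ : x * (y * (w⁻¹ * x))⁻¹ = w * y⁻¹ := by group
    simp only [Equiv.coe_mulRight, h₁, inv_mul_cancel_left, hL.inv_eq]
    split_ifs <;> ring
  · intro w _
    refine summable_of_hasFiniteSupport (hfin.subset fun y hy h => hy ?_)
    simp only at h
    simp [h]

/-- For a fixed right translation, the slices of the kernel are controlled by one truncated
operator applied to a vector supported in the small ball. -/
lemma sum_sq_slice_le {L : G → ℝ} (hL : IsLengthFunction L) (hP : IsProperLF L) (f : G →₀ ℂ)
    {r s t : ℝ} (hr : 0 < r) (hrs : 2 * r ≤ s) (v : G → ℂ) :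
    ∑ w ∈ annulusFinset hP s t, ‖∑' y : G, if L y ≤ r then f (w * y⁻¹) * v y else 0‖ ^ 2 ≤
      (JD L f / r) ^ 2 * ∑ y ∈ (hP r).toFinset, ‖v y‖ ^ 2 := by
  obtain ⟨S, hS, -⟩ := exists_isTruncOp hP f r
  have hn : ‖S‖ ≤ JD L f / r := by
    rw [le_div_iff₀' hr]
    exact mul_norm_le_JD hL hP f hr hS
  rw [← norm_l2Restrict_sq (hP r).toFinset]
  set η := l2Restrict (hP r).toFinset v with hη
  have hSη : ∀ w ∈ annulusFinset hP s t,
      S η w = ∑' y : G, if L y ≤ r then f (w * y⁻¹) * v y else 0 := by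
    intro w hw
    rw [hS, if_neg (by linarith [((mem_annulusFinset hP).mp hw).1])]
    refine tsum_congr fun y => ?_
    split_ifs with hy
    · rw [hη, l2Restrict_apply, if_pos (by simpa [lball] using hy)]
    · rfl
  calc _ = ∑ w ∈ annulusFinset hP s t, ‖S η w‖ ^ 2 :=
        Finset.sum_congr rfl fun w hw => by rw [hSη w hw]
    _ ≤ ‖S η‖ ^ 2 := l2_sum_sq_le _ _
    _ ≤ (JD L f / r * ‖η‖) ^ 2 := by
        gcongr
        exact S.le_of_opNorm_le hn η
    _ = _ := mul_pow _ _ _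

/-- The Cauchy–Schwarz bound `‖λ_{g_n f}‖ ≤ ‖h_n‖₂ ‖k_n‖₂ · J_D(f) / R^{n-1}`, squared and evaluated
on finitely many coordinates. -/
lemma IsConvOp.sum_sq_le {L : G → ℝ} (hL : IsLengthFunction L) (hP : IsProperLF L) {R : ℝ}
    (hR : 2 ≤ R) {n : ℕ} (hn : 1 ≤ n) {f : G →₀ ℂ} {T : l2 G →L[ℂ] l2 G}
    (hT : IsConvOp (fun x => gCut L R n x * f x) T) (ξ : l2 G) (s : Finset G) :
    ∑ x ∈ s, ‖T ξ x‖ ^ 2 ≤ (lball L (R ^ (n + 1))).ncard / (lball L (R ^ (n - 1))).ncard *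
      (JD L f / R ^ (n - 1)) ^ 2 * ‖ξ‖ ^ 2 := by
  classical
  set r := R ^ (n - 1) with hrdef
  set A := annulusFinset hP (R ^ n) (R ^ (n + 1))
  set b : ℝ := ((lball L r).ncard : ℝ)
  set c := (JD L f / r) ^ 2
  have hr : 0 < r := by positivity
  have hrs : 2 * r ≤ R ^ n := by
    rw [hrdef, ← Nat.sub_add_cancel hn, pow_succ', Nat.add_sub_cancel]
    gcongr
  have hb0 : 0 < b := Nat.cast_pos.mpr (ncard_lball_pos hL hP hr.le)
  have hAcard : (A.card : ℝ) ≤ (lball L (R ^ (n + 1))).ncard := by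
    rw [Set.ncard_eq_toFinset_card _ (hP _)]
    exact_mod_cast Finset.card_le_card fun x hx => by
      simpa [lball] using ((mem_annulusFinset hP).mp hx).2
  let F : G → G → ℂ := fun u w => ∑' y : G, if L y ≤ r then f (w * y⁻¹) * ξ (y * u) else 0
  have hpt : ∀ x, ‖T ξ x‖ ^ 2 ≤ b⁻¹ ^ 2 * (A.card * ∑ w ∈ A, ‖F (w⁻¹ * x) w‖ ^ 2) := by
    intro x
    rw [hT.apply_eq_sum hL hP, norm_mul, mul_pow, norm_inv, Complex.norm_natCast]
    gcongr
    calc _ ≤ (∑ w ∈ A, ‖F (w⁻¹ * x) w‖) ^ 2 := by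
          gcongr
          exact norm_sum_le _ _
      _ ≤ _ := sq_sum_le_card_mul_sum_sq
  let U : Finset G := (A ×ˢ s).image fun p => p.1⁻¹ * p.2
  have hU : ∑ x ∈ s, ∑ w ∈ A, ‖F (w⁻¹ * x) w‖ ^ 2 ≤ ∑ u ∈ U, ∑ w ∈ A, ‖F u w‖ ^ 2 := by
    rw [Finset.sum_comm, Finset.sum_comm (s := U)]
    refine Finset.sum_le_sum fun w hw => ?_
    rw [← Finset.sum_image (f := fun u => ‖F u w‖ ^ 2) (g := fun x => w⁻¹ * x) (s := s)
      (mul_right_injective w⁻¹).injOn]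
    refine Finset.sum_le_sum_of_subset_of_nonneg ?_ fun _ _ _ => by positivity
    intro u hu
    obtain ⟨x, hx, rfl⟩ := Finset.mem_image.mp hu
    exact Finset.mem_image.mpr ⟨(w, x), Finset.mk_mem_product hw hx, rfl⟩
  have hξ : ∀ y, ∑ u ∈ U, ‖ξ (y * u)‖ ^ 2 ≤ ‖ξ‖ ^ 2 := by
    intro y
    rw [← Finset.sum_image (f := fun u => ‖ξ u‖ ^ 2) (g := fun u => y * u) (s := U)
      (mul_right_injective y).injOn]
    exact l2_sum_sq_le _ _
  have hsum : ∑ u ∈ U, ∑ w ∈ A, ‖F u w‖ ^ 2 ≤ c * (b * ‖ξ‖ ^ 2) := by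
    calc _ ≤ ∑ u ∈ U, c * ∑ y ∈ (hP r).toFinset, ‖ξ (y * u)‖ ^ 2 :=
          Finset.sum_le_sum fun u _ => sum_sq_slice_le hL hP f hr hrs fun y => ξ (y * u)
      _ = c * ∑ y ∈ (hP r).toFinset, ∑ u ∈ U, ‖ξ (y * u)‖ ^ 2 := by
          rw [← Finset.mul_sum, Finset.sum_comm]
      _ ≤ c * ∑ y ∈ (hP r).toFinset, ‖ξ‖ ^ 2 := by
          gcongr with y
          exact hξ y
      _ = _ := by
          rw [Finset.sum_const, nsmul_eq_mul, ← Set.ncard_eq_toFinset_card _ (hP r)]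
  calc _ ≤ ∑ x ∈ s, b⁻¹ ^ 2 * (A.card * ∑ w ∈ A, ‖F (w⁻¹ * x) w‖ ^ 2) :=
        Finset.sum_le_sum fun x _ => hpt x
    _ = b⁻¹ ^ 2 * (A.card * ∑ x ∈ s, ∑ w ∈ A, ‖F (w⁻¹ * x) w‖ ^ 2) := by
        rw [← Finset.mul_sum, ← Finset.mul_sum]
    _ ≤ b⁻¹ ^ 2 * ((lball L (R ^ (n + 1))).ncard * (c * (b * ‖ξ‖ ^ 2))) := by
        gcongr
        exact hU.trans hsum
    _ = _ := by
        field_simp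

lemma ncard_lball_two_pow_mul_le {α : Type*} {L : α → ℝ} {CL : ℝ} (hCL : 0 ≤ CL)
    (h : ∀ r : ℝ, 1 ≤ r → ((lball L (2 * r)).ncard : ℝ) ≤ CL * ((lball L r).ncard : ℝ))
    {r : ℝ} (hr : 1 ≤ r) (j : ℕ) :
    ((lball L (2 ^ j * r)).ncard : ℝ) ≤ CL ^ j * (lball L r).ncard := by
  induction j with
  | zero => simp
  | succ j ih =>
    rw [pow_succ', mul_assoc, pow_succ', mul_assoc]
    exact (h _ (one_le_mul_of_one_le_of_one_le (one_le_pow₀ one_le_two) hr)).trans (by gcongr)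

/-- there is `C₁ < ∞`, depending only on the doubling constant `C_L`
and `R = 2^K` (`K ≥ 2`), such that `‖λ_{g_n·f}‖ ≤ C₁ R^{−n} J_D(f)` for every
finitely supported `f` and every `n ≥ 1`. -/
theorem exists_const_norm_gCut_mul_le :
    ∀ (CL : ℝ) (K : ℕ), 2 ≤ K →
    ∃ C₁ : ℝ, ∀ (G : Type*) [Group G] (L : G → ℝ),
      IsLengthFunction L → IsProperLF L →
      (∀ r : ℝ, 1 ≤ r →
        ((lball L (2 * r)).ncard : ℝ) ≤ CL * ((lball L r).ncard : ℝ)) →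
      ∀ f : G →₀ ℂ, ∀ n : ℕ, 1 ≤ n → ∀ T : l2 G →L[ℂ] l2 G,
        IsConvOp (fun x => gCut L ((2 : ℝ) ^ K) n x * f x) T →
        ‖T‖ ≤ C₁ * (((2 : ℝ) ^ K) ^ n)⁻¹ * JD L (f : G → ℂ) := by
  intro CL K hK
  refine ⟨|CL| ^ K * 2 ^ K, fun G _ L hL hP hdbl f n hn T hT => ?_⟩
  have hR : (2 : ℝ) ≤ 2 ^ K := le_self_pow₀ one_le_two (by omega)
  set R : ℝ := 2 ^ K with hRdef
  set r := R ^ (n - 1) with hrdef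
  have hr : 1 ≤ r := one_le_pow₀ (by linarith)
  have hRn : R ^ n = R * r := by
    rw [hrdef, ← pow_succ', Nat.sub_add_cancel hn]
  have hb0 : (0 : ℝ) < (lball L r).ncard :=
    Nat.cast_pos.mpr (ncard_lball_pos hL hP (zero_le_one.trans hr))
  have hratio : ((lball L (R ^ (n + 1))).ncard : ℝ) / (lball L r).ncard ≤ (|CL| ^ K) ^ 2 := by
    have hpow : R ^ (n + 1) = 2 ^ (K * 2) * r := by
      rw [pow_succ', hRn, pow_mul]
      ring
    rw [div_le_iff₀ hb0, hpow, ← pow_mul]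
    refine ncard_lball_two_pow_mul_le (abs_nonneg CL) (fun ρ hρ => (hdbl ρ hρ).trans ?_) hr _
    gcongr
    exact le_abs_self CL
  have hJ : 0 ≤ JD L f := by
    obtain ⟨S, hS, -⟩ := exists_isTruncOp hP f 1
    exact (mul_nonneg zero_le_one (norm_nonneg S)).trans
      (mul_norm_le_JD hL hP f zero_lt_one hS)
  have hconst : |CL| ^ K * R * (R ^ n)⁻¹ * JD L f = |CL| ^ K * (JD L f / r) := by
    rw [hRn]
    field_simp
  rw [hconst]
  refine T.opNorm_le_bound (by positivity) fun ξ =>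
    l2_norm_le_of_forall_sum_sq_le (by positivity) fun s => ?_
  calc _ ≤ _ := hT.sum_sq_le hL hP hR hn ξ s
    _ ≤ (|CL| ^ K) ^ 2 * (JD L f / r) ^ 2 * ‖ξ‖ ^ 2 := by gcongr
    _ = _ := by ring
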